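/- D₂(ℂ) = A₂(ℂ) = {d > 0 : d² ∈ ℚ}. -/

import Mathlib

/-- `φ₂((x₁,x₂),(y₁,y₂)) = (x₁−y₁)² + (x₂−y₂)²` on `ℂ²`. -/
noncomputable def phi2 (x y : Fin 2 → ℂ) : ℂ := (x 0 - y 0) ^ 2 + (x 1 - y 1) ^ 2

/-- `D₂(ℂ)`: the set of all real `d > 0` such that for all `x, y ∈ ℝ²` with
`|x−y| = d` there is a finite set `S` with `{x,y} ⊆ S ⊆ ℝ²` such that every map
`f : S → ℂ²` preserving unit distance satisfies `φ₂(f(x),f(y)) = d²`. -/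
def D2 : Set ℝ :=
  {d | 0 < d ∧ ∀ x y : EuclideanSpace ℝ (Fin 2), dist x y = d →
    ∃ S : Set (EuclideanSpace ℝ (Fin 2)), S.Finite ∧ x ∈ S ∧ y ∈ S ∧
      ∀ f : EuclideanSpace ℝ (Fin 2) → (Fin 2 → ℂ),
        (∀ u ∈ S, ∀ v ∈ S, dist u v = 1 → phi2 (f u) (f v) = 1) →
        phi2 (f x) (f y) = ((d ^ 2 : ℝ) : ℂ)}

/-- `A₂(ℂ)`: the set of all real `d > 0` such that every map `f : ℝ² → ℂ²`
preserving unit distance also preserves distance `d`. -/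
def A2 : Set ℝ :=
  {d | 0 < d ∧ ∀ f : EuclideanSpace ℝ (Fin 2) → (Fin 2 → ℂ),
    (∀ x y : EuclideanSpace ℝ (Fin 2), dist x y = 1 → phi2 (f x) (f y) = 1) →
    ∀ x y : EuclideanSpace ℝ (Fin 2), dist x y = d → phi2 (f x) (f y) = ((d ^ 2 : ℝ) : ℂ)}

open IntermediateField in
theorem Transcendental.notMem_adjoin_sq {F E : Type*} [Field F] [Field E] [Algebra F E] {t : E}
    (ht : Transcendental F t) : t ∉ F⟮t ^ 2⟯ := by
  intro hmem
  obtain ⟨p, q, hpq⟩ := (mem_adjoin_simple_iff F t).1 hmem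
  have ht0 : t ≠ 0 := by
    rintro rfl
    exact ht isAlgebraic_zero
  have hq : Polynomial.aeval (t ^ 2) q ≠ 0 := by
    intro h
    rw [h, div_zero] at hpq
    exact ht0 hpq
  have hq0 : q ≠ 0 := by
    rintro rfl
    simp at hq
  have hz : Polynomial.X * Polynomial.expand F 2 q - Polynomial.expand F 2 p = 0 := by
    refine (transcendental_iff.1 ht) _ ?_
    rw [map_sub, map_mul, Polynomial.aeval_X, Polynomial.expand_aeval, Polynomial.expand_aeval, sub_eq_zero]
    exact (eq_div_iff hq).1 hpq
  have hdeg := congrArg Polynomial.natDegree (sub_eq_zero.1 hz)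
  rw [Polynomial.natDegree_X_mul ((Polynomial.expand_ne_zero two_pos).2 hq0), Polynomial.natDegree_expand, Polynomial.natDegree_expand] at hdeg
  omega

open IntermediateField in
theorem Transcendental.mem_range_algebraMap_of_mem_adjoin {F E : Type*} [Field F] [Field E]
    [Algebra F E] {s t : E} (hs : Transcendental F s) (ht : IsAlgebraic F t) (hmem : t ∈ F⟮s⟯) :
    t ∈ Set.range (algebraMap F E) := by
  let e := RatFunc.algEquivOfTranscendental s hs
  have halg : IsAlgebraic F (e.symm ⟨t, hmem⟩) := by
    have h : IsAlgebraic F (⟨t, hmem⟩ : F⟮s⟯) :=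
      (isAlgebraic_algebraMap_iff (algebraMap F⟮s⟯ E).injective).1 ht
    exact h.algHom e.symm.toAlgHom
  by_contra hne
  refine (RatFunc.transcendental_of_ne_C _ ?_) halg
  rintro ⟨c, hc⟩
  apply hne
  refine ⟨c, ?_⟩
  have h1 : e (RatFunc.C c) = ⟨t, hmem⟩ := by rw [← hc]; simp
  rw [← RatFunc.algebraMap_eq_C, e.commutes] at h1
  exact congrArg Subtype.val h1

open IntermediateField in
theorem IntermediateField.exists_maximal_notMem {F E : Type*} [Field F] [Field E] [Algebra F E]
    {t : E} (ht : t ∉ Set.range (algebraMap F E)) :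
    ∃ M : IntermediateField F E, Maximal (fun K => t ∉ K) M := by
  have hub : ∀ c ⊆ {K : IntermediateField F E | t ∉ K}, IsChain (· ≤ ·) c → ∀ K ∈ c,
      ∃ ub ∈ {K : IntermediateField F E | t ∉ K}, ∀ z ∈ c, z ≤ ub := by
    refine fun c hc hchain K hK => ⟨sSup c, fun hmem => ?_, fun _ => le_sSup⟩
    have : Nonempty c := ⟨⟨K, hK⟩⟩
    rw [sSup_eq_iSup', ← SetLike.mem_coe, coe_iSup_of_directed hchain.directedOn.directed_val,
      Set.mem_iUnion] at hmem
    obtain ⟨L, hL⟩ := hmem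
    exact hc L.2 hL
  obtain ⟨M, -, hM⟩ := zorn_le_nonempty₀ _ hub ⊥ (by simpa [mem_bot] using ht)
  exact ⟨M, hM⟩

open IntermediateField in
theorem IntermediateField.isAlgebraic_of_maximal_notMem {F E : Type*} [Field F] [Field E]
    [Algebra F E] {t : E} {M : IntermediateField F E} (hM : Maximal (fun K => t ∉ K) M) :
    Algebra.IsAlgebraic M E := by
  have key : ∀ s : E, s ∉ M → t ∈ M⟮s⟯ := by
    intro s hs
    by_contra h
    have hle : M ≤ (M⟮s⟯).restrictScalars F := fun x hx =>
      (M⟮s⟯).algebraMap_mem (⟨x, hx⟩ : M)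
    exact hs (hM.2 (y := (M⟮s⟯).restrictScalars F) h hle (mem_adjoin_simple_self M s))
  have hnot : ∀ s : E, Transcendental M s → s ∉ M := fun s hs hmem =>
    hs (isAlgebraic_algebraMap (⟨s, hmem⟩ : M))
  have ht : IsAlgebraic M t := by
    by_contra h
    exact Transcendental.notMem_adjoin_sq h (key _ (hnot _ (Transcendental.pow h two_pos)))
  refine ⟨fun s => ?_⟩
  by_contra h
  obtain ⟨c, hc⟩ := Transcendental.mem_range_algebraMap_of_mem_adjoin h ht (key s (hnot s h))
  exact hM.1 (hc ▸ c.2)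

theorem IsAlgClosed.exists_algEquiv_apply_ne {F E : Type*} [Field F] [Field E] [CharZero F]
    [Algebra F E] [IsAlgClosed E] {t : E} (ht : t ∉ Set.range (algebraMap F E)) :
    ∃ σ : E ≃ₐ[F] E, σ t ≠ t := by
  obtain ⟨M, hM⟩ := IntermediateField.exists_maximal_notMem ht
  have := IntermediateField.isAlgebraic_of_maximal_notMem hM
  have : IsAlgClosure M E := ⟨inferInstance, inferInstance⟩
  have : IsGalois M E := ⟨⟩
  by_contra! h
  obtain ⟨c, hc⟩ := (InfiniteGalois.mem_range_algebraMap_iff_fixed (k := M) t).2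
    fun σ => h (σ.restrictScalars F)
  exact hM.1 (hc ▸ c.2)

/-- The Euclidean plane. -/
abbrev Plane := EuclideanSpace ℝ (Fin 2)

/-- The squared Euclidean distance in coordinates. -/
def nsq (x y : Plane) : ℝ := (x 0 - y 0) ^ 2 + (x 1 - y 1) ^ 2

theorem nsq_eq_dist_sq (x y : Plane) : nsq x y = dist x y ^ 2 := by
  rw [EuclideanSpace.dist_eq, Real.sq_sqrt (by positivity)]
  simp [nsq, Real.dist_eq, sq_abs]

theorem nsq_comm (x y : Plane) : nsq x y = nsq y x := by
  simp only [nsq]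
  ring

theorem dist_eq_one_iff_nsq (x y : Plane) : dist x y = 1 ↔ nsq x y = 1 := by
  rw [nsq_eq_dist_sq, pow_eq_one_iff_of_nonneg dist_nonneg two_ne_zero]

/-- A property of maps `ℝ² → ℂ²` holds eventually along this filter when it follows from the
preservation of unit distance on some finite subset of the plane. -/
def unitFilter : Filter (Plane → Fin 2 → ℂ) where
  sets := {Q | ∃ S : Set Plane, S.Finite ∧
    ∀ f : Plane → Fin 2 → ℂ, (∀ u ∈ S, ∀ v ∈ S, dist u v = 1 → phi2 (f u) (f v) = 1) → f ∈ Q}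
  univ_sets := ⟨∅, Set.finite_empty, fun _ _ => trivial⟩
  sets_of_superset := by
    rintro P Q ⟨S, hS, h⟩ hPQ
    exact ⟨S, hS, fun f hf => hPQ (h f hf)⟩
  inter_sets := by
    rintro P Q ⟨S, hS, hP⟩ ⟨T, hT, hQ⟩
    exact ⟨S ∪ T, hS.union hT, fun f hf =>
      ⟨hP f fun u hu v hv => hf u (.inl hu) v (.inl hv),
        hQ f fun u hu v hv => hf u (.inr hu) v (.inr hv)⟩⟩

theorem eventually_unitFilter {Q : (Plane → Fin 2 → ℂ) → Prop} :
    (∀ᶠ f in unitFilter, Q f) ↔ ∃ S : Set Plane, S.Finite ∧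
      ∀ f : Plane → Fin 2 → ℂ,
        (∀ u ∈ S, ∀ v ∈ S, dist u v = 1 → phi2 (f u) (f v) = 1) → Q f :=
  Iff.rfl

/-- The squared distance `q` is preserved by all maps that preserve unit distance on a suitable
finite set. -/
def PreservesSq (q : ℝ) : Prop :=
  ∀ x y : Plane, nsq x y = q → ∀ᶠ f in unitFilter, phi2 (f x) (f y) = (q : ℂ)

theorem mem_D2_iff {d : ℝ} : d ∈ D2 ↔ 0 < d ∧ PreservesSq (d ^ 2) := by
  refine and_congr_right fun hd => ?_
  have hdist : ∀ x y : Plane, nsq x y = d ^ 2 ↔ dist x y = d := fun x y => by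
    rw [nsq_eq_dist_sq, sq_eq_sq₀ dist_nonneg hd.le]
  constructor
  · intro h x y hxy
    obtain ⟨S, hS, -, -, hf⟩ := h x y ((hdist x y).1 hxy)
    exact ⟨S, hS, hf⟩
  · intro h x y hxy
    obtain ⟨S, hS, hf⟩ := eventually_unitFilter.1 (h x y ((hdist x y).2 hxy))
    exact ⟨insert x (insert y S), (hS.insert y).insert x, by simp, by simp, fun f h' =>
      hf f fun u hu v hv => h' u (by simp [hu]) v (by simp [hv])⟩

theorem preservesSq_one : PreservesSq 1 := by
  intro x y hxy
  refine ⟨{x, y}, by simp, fun f hf => ?_⟩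
  simpa using hf x (by simp) y (by simp) ((dist_eq_one_iff_nsq x y).2 hxy)

/-- The point with coordinates `(s, t)` in the frame with origin `x` whose first basis vector is
`y - x` and whose second one is `y - x` turned by a right angle. -/
noncomputable def framePt (x y : Plane) (s t : ℝ) : Plane :=
  !₂[x 0 + s * (y 0 - x 0) - t * (y 1 - x 1), x 1 + s * (y 1 - x 1) + t * (y 0 - x 0)]

@[simp]
theorem framePt_apply_zero (x y : Plane) (s t : ℝ) :
    framePt x y s t 0 = x 0 + s * (y 0 - x 0) - t * (y 1 - x 1) := by
  simp [framePt]

@[simp]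
theorem framePt_apply_one (x y : Plane) (s t : ℝ) :
    framePt x y s t 1 = x 1 + s * (y 1 - x 1) + t * (y 0 - x 0) := by
  simp [framePt]

theorem nsq_framePt_framePt (x y : Plane) (s t s' t' : ℝ) :
    nsq (framePt x y s t) (framePt x y s' t') = nsq x y * ((s - s') ^ 2 + (t - t') ^ 2) := by
  simp only [nsq, framePt_apply_zero, framePt_apply_one]
  ring

@[simp]
theorem framePt_zero_zero (x y : Plane) : framePt x y 0 0 = x := by
  ext i
  fin_cases i <;> simp

@[simp]
theorem framePt_one_zero (x y : Plane) : framePt x y 1 0 = y := by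
  ext i
  fin_cases i <;> simp

theorem nsq_left_framePt (x y : Plane) (s t : ℝ) :
    nsq x (framePt x y s t) = nsq x y * (s ^ 2 + t ^ 2) := by
  simp only [nsq, framePt_apply_zero, framePt_apply_one]
  ring

theorem nsq_right_framePt (x y : Plane) (s t : ℝ) :
    nsq y (framePt x y s t) = nsq x y * ((1 - s) ^ 2 + t ^ 2) := by
  simp only [nsq, framePt_apply_zero, framePt_apply_one]
  ring

theorem phi2_rhombus {A B C D : Fin 2 → ℂ} {a b : ℂ} (hb : b ≠ 0) (hAB : phi2 A B = a)
    (hAC : phi2 A C = a) (hDB : phi2 D B = a) (hDC : phi2 D C = a) (hBC : phi2 B C = b) :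
    A = D ∨ (A + D = B + C ∧ phi2 A D = 4 * a - b) := by
  simp only [phi2] at *
  have hcross : ∀ P : Fin 2 → ℂ, (P 0 - B 0) ^ 2 + (P 1 - B 1) ^ 2 = a →
      (P 0 - C 0) ^ 2 + (P 1 - C 1) ^ 2 = a → ∃ α : ℂ, 4 * α ^ 2 * b = 4 * a - b ∧
        P 0 = (B 0 + C 0) / 2 - α * (C 1 - B 1) ∧ P 1 = (B 1 + C 1) / 2 + α * (C 0 - B 0) := by
    intro P hPB hPC
    have hdot : (P 0 - (B 0 + C 0) / 2) * (C 0 - B 0) +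
        (P 1 - (B 1 + C 1) / 2) * (C 1 - B 1) = 0 := by
      linear_combination (hPB - hPC) / 2
    obtain ⟨α, hα⟩ : ∃ α, α * b = (P 1 - (B 1 + C 1) / 2) * (C 0 - B 0) -
        (P 0 - (B 0 + C 0) / 2) * (C 1 - B 1) := ⟨_, div_mul_cancel₀ _ hb⟩
    have h0 : P 0 = (B 0 + C 0) / 2 - α * (C 1 - B 1) := by
      refine mul_left_cancel₀ hb ?_
      linear_combination (C 0 - B 0) * hdot + (C 1 - B 1) * hα -
        (P 0 - (B 0 + C 0) / 2) * hBC
    have h1 : P 1 = (B 1 + C 1) / 2 + α * (C 0 - B 0) := by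
      refine mul_left_cancel₀ hb ?_
      linear_combination (C 1 - B 1) * hdot - (C 0 - B 0) * hα -
        (P 1 - (B 1 + C 1) / 2) * hBC
    refine ⟨α, ?_, h0, h1⟩
    rw [h0, h1] at hPB
    linear_combination 4 * hPB - (1 + 4 * α ^ 2) * hBC
  obtain ⟨α, hα, hA0, hA1⟩ := hcross A hAB hAC
  obtain ⟨δ, hδ, hD0, hD1⟩ := hcross D hDB hDC
  have hsq : α ^ 2 = δ ^ 2 := mul_right_cancel₀ hb (by linear_combination (hα - hδ) / 4)
  rcases sq_eq_sq_iff_eq_or_eq_neg.1 hsq with rfl | rfl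
  · left
    ext i
    fin_cases i
    · exact hA0.trans hD0.symm
    · exact hA1.trans hD1.symm
  · right
    refine ⟨?_, ?_⟩
    · ext i
      fin_cases i
      · simp [hA0, hD0]
      · simp [hA1, hD1]
        ring
    · rw [hA0, hA1, hD0, hD1]
      linear_combination hδ + 4 * δ ^ 2 * hBC

/-- Opposite vertices of a rhombus. -/
theorem eventually_rhombus {a b : ℝ} (ha : PreservesSq a) (hb : PreservesSq b) (hb0 : 0 < b)
    (hc : 0 < 4 * a - b) {x y : Plane} (hxy : nsq x y = 4 * a - b) :
    ∀ᶠ f in unitFilter, f x = f y ∨ phi2 (f x) (f y) = ((4 * a - b : ℝ) : ℂ) := by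
  have hroot : √(b / (4 * a - b)) ^ 2 = b / (4 * a - b) := Real.sq_sqrt (by positivity)
  set t := √(b / (4 * a - b)) with ht
  have ht2 : (4 * a - b) * t ^ 2 = b := by rw [hroot]; field_simp
  filter_upwards [ha x (framePt x y (1 / 2) (t / 2)) (by rw [nsq_left_framePt, hxy]; linarith),
    ha x (framePt x y (1 / 2) (-t / 2)) (by rw [nsq_left_framePt, hxy]; linarith),
    ha y (framePt x y (1 / 2) (t / 2)) (by rw [nsq_right_framePt, hxy]; linarith),
    ha y (framePt x y (1 / 2) (-t / 2)) (by rw [nsq_right_framePt, hxy]; linarith),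
    hb (framePt x y (1 / 2) (t / 2)) (framePt x y (1 / 2) (-t / 2))
      (by rw [nsq_framePt_framePt, hxy]; linarith)] with f h1 h2 h3 h4 h5
  rcases phi2_rhombus (by exact_mod_cast hb0.ne') h1 h2 h3 h4 h5 with h | h
  · exact .inl h
  · exact .inr (by rw [h.2]; push_cast; ring)

/-- The generalized Moser spindle: the second rhombus has its tip at squared distance `e` from the
tip of the first one. -/
theorem PreservesSq.rhombus {a b e : ℝ} (ha : PreservesSq a) (hb : PreservesSq b)
    (he : PreservesSq e) (hb0 : 0 < b) (hc : 0 < 4 * a - b) (he0 : 0 < e)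
    (hle : e ≤ 4 * (4 * a - b)) (hne : e ≠ 4 * a - b) : PreservesSq (4 * a - b) := by
  intro x y hxy
  set c := 4 * a - b with hcdef
  set s := 1 - e / (2 * c) with hs
  have hse : c * (2 - 2 * s) = e := by rw [hs]; field_simp; ring
  have hs1 : s ≤ 1 := by rw [hs]; linarith [show 0 ≤ e / (2 * c) by positivity]
  have hs2 : -1 ≤ s := by
    have : e / (2 * c) ≤ 2 := by rw [div_le_iff₀ (by positivity)]; linarith
    linarith
  have ht2 : √(1 - s ^ 2) ^ 2 = 1 - s ^ 2 := Real.sq_sqrt (by nlinarith)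
  have hxz : nsq x (framePt x y s √(1 - s ^ 2)) = c := by
    rw [nsq_left_framePt, ht2, hxy]; ring
  have hyz : nsq y (framePt x y s √(1 - s ^ 2)) = e := by
    rw [nsq_right_framePt, ht2, hxy, ← hse]; ring
  filter_upwards [eventually_rhombus ha hb hb0 hc hxy, eventually_rhombus ha hb hb0 hc hxz,
    he _ _ hyz] with f h1 h2 h3
  rcases h1 with h1 | h1
  · rw [← h1] at h3
    rcases h2 with h2 | h2
    · rw [← h2] at h3
      simp only [phi2, sub_self] at h3
      norm_num at h3
      exact absurd (by exact_mod_cast h3.symm) he0.ne'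
    · rw [h2] at h3
      exact absurd (by exact_mod_cast h3.symm) hne
  · exact h1

theorem preservesSq_three : PreservesSq 3 := by
  have h := preservesSq_one.rhombus preservesSq_one preservesSq_one (by norm_num) (by norm_num)
    (by norm_num) (by norm_num) (by norm_num)
  norm_num at h
  exact h

theorem eventually_midpoint {A M B : Plane} (hAM : nsq A M = 1) (hM : framePt A M 2 0 = B) :
    ∀ᶠ f in unitFilter, f A + f B = 2 • f M := by
  have h3 : √3 ^ 2 = 3 := Real.sq_sqrt (by norm_num)
  set C := framePt A M (1 / 2) (√3 / 2) with hC
  set D := framePt A M (3 / 2) (√3 / 2) with hD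
  have hCB : nsq C B = 3 := by
    rw [hC, ← hM, nsq_framePt_framePt, hAM]
    linarith
  have hDB : nsq D B = 1 := by
    rw [hD, ← hM, nsq_framePt_framePt, hAM]
    linarith
  have hCD : nsq C D = 1 := by
    rw [hC, hD, nsq_framePt_framePt, hAM]
    norm_num
  have hMB : nsq M B = 1 := by
    rw [← hM, nsq_right_framePt, hAM]
    norm_num
  have hAC : nsq A C = 1 := by rw [nsq_left_framePt, hAM]; linarith
  have hMC : nsq M C = 1 := by rw [nsq_right_framePt, hAM]; linarith
  have hAD : nsq A D = 3 := by rw [nsq_left_framePt, hAM]; linarith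
  have hMD : nsq M D = 1 := by rw [nsq_right_framePt, hAM]; linarith
  have e1 := preservesSq_one
  have e3 := preservesSq_three
  filter_upwards [e1 _ _ hAC, e1 _ _ hAM, e1 D C (by rw [nsq_comm, hCD]),
    e1 D M (by rw [nsq_comm, hMD]), e1 C M (by rw [nsq_comm, hMC]), e3 _ _ hAD,
    e1 _ _ hCD, e1 B M (by rw [nsq_comm, hMB]), e1 B D (by rw [nsq_comm, hDB]),
    e1 _ _ hMD, e3 _ _ hCB] with f fAC fAM fDC fDM fCM fAD fCD fBM fBD fMD fCB
  have hne : ∀ {X Y : Fin 2 → ℂ}, phi2 X Y = ((3 : ℝ) : ℂ) → X ≠ Y := by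
    rintro X _ h rfl
    simp [phi2] at h
  have hb : ((1 : ℝ) : ℂ) ≠ 0 := by simp
  have h1 := ((phi2_rhombus hb fAC fAM fDC fDM fCM).resolve_left (hne fAD)).1
  have h2 := ((phi2_rhombus hb fCM fCD fBM fBD fMD).resolve_left (hne fCB)).1
  rw [two_smul]
  linear_combination h1 + h2

theorem eventually_framePt_natCast {x y : Plane} (hxy : nsq x y = 1) (n : ℕ) :
    ∀ᶠ f in unitFilter, f (framePt x y n 0) = f x + (n : ℂ) • (f y - f x) := by
  have h : ∀ n : ℕ, ∀ᶠ f in unitFilter, f (framePt x y n 0) = f x + (n : ℂ) • (f y - f x) ∧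
      f (framePt x y (n + 1 : ℕ) 0) = f x + ((n + 1 : ℕ) : ℂ) • (f y - f x) := by
    intro n
    induction n with
    | zero => simp
    | succ n ih =>
      have hunit : nsq (framePt x y n 0) (framePt x y (n + 1 : ℕ) 0) = 1 := by
        rw [nsq_framePt_framePt, hxy]
        push_cast
        ring
      have hpt : framePt (framePt x y n 0) (framePt x y (n + 1 : ℕ) 0) 2 0 =
          framePt x y (n + 1 + 1 : ℕ) 0 := by
        ext i
        fin_cases i <;> simp <;> ring
      filter_upwards [ih, eventually_midpoint hunit hpt] with f hf hmid
      refine ⟨hf.2, ?_⟩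
      rw [← eq_sub_iff_add_eq'] at hmid
      rw [hmid, hf.1, hf.2]
      ext i
      simp
      ring
  filter_upwards [h n] with f hf using hf.1

theorem preservesSq_div_sq {p q : ℕ} (hp : 0 < p) (hq : 0 < q) :
    PreservesSq ((p / q : ℝ) ^ 2) := by
  intro x y hxy
  have hp' : (0 : ℝ) < p := by exact_mod_cast hp
  have hq' : (1 : ℝ) ≤ q := by exact_mod_cast hq
  have hq0 : (q : ℝ) ≠ 0 := by positivity
  have ht : √((q : ℝ) ^ 2 - 1 / 4) ^ 2 = (q : ℝ) ^ 2 - 1 / 4 := Real.sq_sqrt (by nlinarith)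
  set C := framePt x y (1 / 2) √((q : ℝ) ^ 2 - 1 / 4) with hC
  have hCx : nsq C x = (p : ℝ) ^ 2 := by
    rw [nsq_comm, hC, nsq_left_framePt, ht, hxy]
    field_simp
    ring
  have hCy : nsq C y = (p : ℝ) ^ 2 := by
    rw [nsq_comm, hC, nsq_right_framePt, ht, hxy]
    field_simp
    ring
  clear_value C
  set U := framePt C x (1 / p) 0 with hU
  set V := framePt C y (1 / p) 0 with hV
  have hCU : nsq C U = 1 := by rw [hU, nsq_left_framePt, hCx]; field_simp; ring
  have hCV : nsq C V = 1 := by rw [hV, nsq_left_framePt, hCy]; field_simp; ring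
  have hx : framePt C U p 0 = x := by
    ext i
    fin_cases i <;> simp [hU] <;> field_simp <;> ring
  have hy : framePt C V p 0 = y := by
    ext i
    fin_cases i <;> simp [hV] <;> field_simp <;> ring
  have hAB : nsq (framePt C U q 0) (framePt C V q 0) = 1 := by
    have : nsq (framePt C U q 0) (framePt C V q 0) = (q / p : ℝ) ^ 2 * nsq x y := by
      simp only [nsq, framePt_apply_zero, framePt_apply_one, hU, hV]
      field_simp
      ring
    rw [this, hxy]
    field_simp
  filter_upwards [eventually_framePt_natCast hCU p, eventually_framePt_natCast hCV p,
    eventually_framePt_natCast hCU q, eventually_framePt_natCast hCV q,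
    preservesSq_one _ _ hAB] with f h1 h2 h3 h4 h5
  rw [hx] at h1
  rw [hy] at h2
  rw [h3, h4] at h5
  rw [h1, h2]
  have hqC : (q : ℂ) ≠ 0 := by exact_mod_cast hq.ne'
  simp only [phi2, Pi.add_apply, Pi.smul_apply, Pi.sub_apply, smul_eq_mul] at h5 ⊢
  push_cast at h5 ⊢
  field_simp
  linear_combination (p : ℂ) ^ 2 * h5

theorem preservesSq_ratCast_sq {r : ℚ} (hr : 0 < r) : PreservesSq ((r : ℝ) ^ 2) := by
  have hnum : 0 < r.num := Rat.num_pos.2 hr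
  have h := preservesSq_div_sq (p := r.num.toNat) (q := r.den) (by omega) r.pos
  have hcast : ((r.num.toNat : ℕ) : ℝ) = (r.num : ℝ) := by
    exact_mod_cast congrArg (Int.cast : ℤ → ℝ) (Int.toNat_of_nonneg hnum.le)
  rwa [hcast, ← Rat.cast_def] at h

theorem preservesSq_ratCast {q : ℚ} (hq : 0 < q) : PreservesSq (q : ℝ) := by
  set t := q + 1
  have ht : 0 < t := by positivity
  have hlt : q / t < t := by
    rw [div_lt_iff₀ ht]
    nlinarith
  have hqt : 0 < q / t := by positivity
  have hid : 4 * ((t + q / t) / 4) ^ 2 - ((t - q / t) / 2) ^ 2 = q := by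
    field_simp
    ring
  have hid' : 4 * (((t + q / t) / 4 : ℚ) : ℝ) ^ 2 - (((t - q / t) / 2 : ℚ) : ℝ) ^ 2 = q := by
    exact_mod_cast hid
  have ha := preservesSq_ratCast_sq (r := (t + q / t) / 4) (by positivity)
  have hb0 : 0 < (t - q / t) / 2 := by linarith
  have hb := preservesSq_ratCast_sq hb0
  obtain ⟨n, hn⟩ := exists_nat_one_div_lt hq
  have he0 : (0 : ℚ) < 1 / (n + 1) := by positivity
  have hsq : (1 / (n + 1) : ℚ) ^ 2 < q := by
    have h1 : (1 / (n + 1) : ℚ) ≤ 1 := by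
      rw [div_le_one (by positivity)]
      linarith [show (0 : ℚ) ≤ n by positivity]
    nlinarith
  have he := preservesSq_ratCast_sq he0
  have hsq' : ((1 / (n + 1) : ℚ) : ℝ) ^ 2 < q := by exact_mod_cast hsq
  have hq' : (0 : ℝ) < q := by exact_mod_cast hq
  have h := ha.rhombus hb he (pow_pos (by exact_mod_cast hb0) 2) (by rw [hid']; exact hq')
    (pow_pos (by exact_mod_cast he0) 2) (by rw [hid']; linarith) (by rw [hid']; exact hsq'.ne)
  rwa [hid'] at h

theorem D2_subset_A2 : D2 ⊆ A2 := by
  rintro d ⟨hd, h⟩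
  refine ⟨hd, fun f hf x y hxy => ?_⟩
  obtain ⟨S, -, -, -, hS⟩ := h x y hxy
  exact hS f fun u _ v _ => hf u v

theorem exists_rat_of_mem_A2 {d : ℝ} (hd : d ∈ A2) : ∃ q : ℚ, (q : ℝ) = d ^ 2 := by
  by_contra! hne
  have hnot : ((d ^ 2 : ℝ) : ℂ) ∉ Set.range (algebraMap ℚ ℂ) := by
    rintro ⟨q, hq⟩
    rw [eq_ratCast] at hq
    exact hne q (by exact_mod_cast hq)
  obtain ⟨σ, hσ⟩ := IsAlgClosed.exists_algEquiv_apply_ne hnot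
  apply hσ
  have hphi : ∀ x y : Plane,
      phi2 (fun i => σ (x i : ℂ)) (fun i => σ (y i : ℂ)) = σ ((nsq x y : ℝ) : ℂ) := by
    intro x y
    simp [phi2, nsq]
  have hdist : nsq !₂[d, 0] !₂[0, 0] = d ^ 2 := by simp [nsq]
  have h := hd.2 (fun x i => σ (x i : ℂ))
    (fun x y hxy => by rw [hphi, (dist_eq_one_iff_nsq x y).1 hxy]; simp) !₂[d, 0] !₂[0, 0]
    ((sq_eq_sq₀ dist_nonneg hd.1.le).1 (by rw [← nsq_eq_dist_sq, hdist]))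
  rwa [hphi, hdist] at h

/-- `D₂(ℂ) = A₂(ℂ) = {d > 0 : d² ∈ ℚ}`. -/
theorem stmt15 :
    D2 = A2 ∧ A2 = {d : ℝ | 0 < d ∧ ∃ q : ℚ, (q : ℝ) = d ^ 2} := by
  have h1 : A2 ⊆ {d : ℝ | 0 < d ∧ ∃ q : ℚ, (q : ℝ) = d ^ 2} :=
    fun d hd => ⟨hd.1, exists_rat_of_mem_A2 hd⟩
  have h2 : {d : ℝ | 0 < d ∧ ∃ q : ℚ, (q : ℝ) = d ^ 2} ⊆ D2 := by
    rintro d ⟨hd, q, hq⟩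
    have hq0 : 0 < q := by
      have : (0 : ℝ) < q := by rw [hq]; positivity
      exact_mod_cast this
    exact mem_D2_iff.2 ⟨hd, hq ▸ preservesSq_ratCast hq0⟩
  exact ⟨D2_subset_A2.antisymm (h1.trans h2), h1.antisymm (h2.trans D2_subset_A2)⟩
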